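/- For every nonnegative integer n, b̅₅(10n+6) = 0 and b̅₅(10n+8) = 0. -/

import Mathlib

open scoped BigOperators

/-- The q-Pochhammer infinite product `(a; q)_∞ = ∏_{k≥0} (1 - a q^k)`. -/
noncomputable def qpoch (a q : ℂ) : ℂ := ∏' k : ℕ, (1 - a * q ^ k)

/-- `φ(-q) = (q;q)_∞² / (q²;q²)_∞`. -/
noncomputable def phiNeg (q : ℂ) : ℂ := qpoch q q ^ 2 / qpoch (q ^ 2) (q ^ 2)

/-- `ψ(-q) = (q;q)_∞ (q⁴;q⁴)_∞ / (q²;q²)_∞`. -/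
noncomputable def psiNeg (q : ℂ) : ℂ :=
  qpoch q q * qpoch (q ^ 4) (q ^ 4) / qpoch (q ^ 2) (q ^ 2)

open Filter Topology


lemma qp_mult (a : ℂ) {q : ℂ} (hq : ‖q‖ < 1) : Multipliable fun k : ℕ => 1 - a * q ^ k := by
  have := multipliable_one_add_of_summable (f := fun k : ℕ => - (a * q ^ k)) (by
    simpa using (summable_geometric_of_lt_one (norm_nonneg _) hq).mul_left ‖a‖)
  simpa [sub_eq_add_neg] using this

lemma qp_tendsto (a : ℂ) {q : ℂ} (hq : ‖q‖ < 1) :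
    Tendsto (fun N : ℕ => ∏ k ∈ Finset.range N, (1 - a * q ^ k)) atTop (𝓝 (qpoch a q)) :=
  (qp_mult a hq).tendsto_prod_tprod_nat

lemma qp_ne {a q : ℂ} (hq : ‖q‖ < 1) (h : ∀ k : ℕ, 1 - a * q ^ k ≠ 0) : qpoch a q ≠ 0 := by
  have := tprod_one_add_ne_zero_of_summable (f := fun k : ℕ => - (a * q ^ k))
    (by simpa [← sub_eq_add_neg] using h) (by
    simpa using (summable_geometric_of_lt_one (norm_nonneg _) hq).mul_left ‖a‖)
  simpa [qpoch, sub_eq_add_neg] using this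

lemma one_sub_ne {x : ℂ} (h : ‖x‖ < 1) : 1 - x ≠ 0 := by
  intro h0
  have : x = 1 := by linear_combination -h0
  simp [this] at h

lemma qp_ne' {a q : ℂ} (hq : ‖q‖ < 1) (ha : ‖a‖ < 1) : qpoch a q ≠ 0 := by
  refine qp_ne hq fun k => one_sub_ne ?_
  rw [norm_mul, norm_pow]
  calc ‖a‖ * ‖q‖ ^ k ≤ ‖a‖ * 1 := by
        gcongr; exact pow_le_one₀ (norm_nonneg _) hq.le
    _ < 1 := by simpa

lemma qp_succ (a : ℂ) {q : ℂ} (hq : ‖q‖ < 1) : qpoch a q = (1 - a) * qpoch (a * q) q := by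
  refine tendsto_nhds_unique ((tendsto_add_atTop_iff_nat 1).2 (qp_tendsto a hq)) ?_
  have := (qp_tendsto (a * q) hq).const_mul (1 - a)
  refine this.congr fun N => ?_
  rw [Finset.prod_range_succ', mul_comm]
  simp only [pow_zero, mul_one]
  congr 1
  exact Finset.prod_congr rfl fun k _ => by ring

lemma norm_pow_lt {q : ℂ} (hq : ‖q‖ < 1) {m : ℕ} (hm : m ≠ 0) : ‖q ^ m‖ < 1 := by
  rw [norm_pow]; exact pow_lt_one₀ (norm_nonneg _) hq hm

lemma qp_split (a : ℂ) {q : ℂ} (hq : ‖q‖ < 1) {m : ℕ} (hm : m ≠ 0) :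
    qpoch a q = ∏ r ∈ Finset.range m, qpoch (a * q ^ r) (q ^ m) := by
  have h1 : Tendsto (fun N : ℕ => m * N) atTop atTop :=
    tendsto_id.const_mul_atTop' (Nat.pos_of_ne_zero hm)
  refine tendsto_nhds_unique ((qp_tendsto a hq).comp h1) ?_
  have := tendsto_finsetProd (Finset.range m) (fun r _ => qp_tendsto (a * q ^ r) (norm_pow_lt hq hm))
  refine this.congr fun N => ?_
  simp only [Function.comp]
  induction N with
  | zero => simp
  | succ N ih =>
    rw [mul_add, mul_one, Finset.prod_range_add, ← ih, ← Finset.prod_mul_distrib]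
    refine Finset.prod_congr rfl fun r _ => ?_
    rw [Finset.prod_range_succ]
    congr 1
    ring

lemma qp_neg (a : ℂ) {q : ℂ} (hq : ‖q‖ < 1) :
    qpoch a q * qpoch (-a) q = qpoch (a ^ 2) (q ^ 2) := by
  refine tendsto_nhds_unique ((qp_tendsto a hq).mul (qp_tendsto (-a) hq)) ?_
  refine (qp_tendsto (a ^ 2) (norm_pow_lt hq two_ne_zero)).congr fun N => ?_
  rw [← Finset.prod_mul_distrib]
  exact Finset.prod_congr rfl fun k _ => by ring

lemma qp_roots (a : ℂ) {q : ℂ} (hq : ‖q‖ < 1) (w : ℂ) (hw : w ^ 4 + w ^ 3 + w ^ 2 + w + 1 = 0) :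
    ∏ i ∈ Finset.range 5, qpoch (w ^ i * a) q = qpoch (a ^ 5) (q ^ 5) := by
  refine tendsto_nhds_unique (tendsto_finsetProd (Finset.range 5)
    fun i _ => qp_tendsto (w ^ i * a) hq) ?_
  refine (qp_tendsto (a ^ 5) (norm_pow_lt hq (by norm_num))).congr fun N => ?_
  rw [Finset.prod_comm]
  refine Finset.prod_congr rfl fun k _ => ?_
  have key : ∀ x : ℂ, (1 - x) * (1 - w * x) * (1 - w ^ 2 * x) * (1 - w ^ 3 * x) * (1 - w ^ 4 * x)
      = 1 - x ^ 5 := by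
    intro x
    have h5 : w ^ 5 = 1 := by linear_combination (w - 1) * hw
    have e6 : w ^ 6 = w := by linear_combination w * h5
    have e7 : w ^ 7 = w ^ 2 := by linear_combination w ^ 2 * h5
    have e8 : w ^ 8 = w ^ 3 := by linear_combination w ^ 3 * h5
    have e9 : w ^ 9 = w ^ 4 := by linear_combination w ^ 4 * h5
    have e10 : w ^ 10 = 1 := by linear_combination (w ^ 5 + 1) * h5
    have e4 : w ^ 4 = -(w ^ 3 + w ^ 2 + w + 1) := by linear_combination hw
    ring_nf
    simp only [e10, e9, e8, e7, e6, h5]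
    ring_nf
    simp only [e4]
    ring
  simp only [Finset.prod_range_succ, Finset.prod_range_zero]
  have := key (a * q ^ k)
  rw [mul_pow, ← pow_mul] at this
  rw [← pow_mul, mul_comm 5 k, ← this]
  ring

lemma qp_norm {q : ℂ} (hq : ‖q‖ < 1) (w : ℂ) (hw : w ^ 4 + w ^ 3 + w ^ 2 + w + 1 = 0) :
    (∏ i ∈ Finset.range 5, qpoch (w ^ i * q) (w ^ i * q)) * qpoch (q ^ 25) (q ^ 25) =
      qpoch (q ^ 5) (q ^ 5) ^ 6 := by
  have h5 : w ^ 5 = 1 := by linear_combination (w - 1) * hw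
  have hwn : ‖w‖ = 1 := by
    have : ‖w‖ ^ 5 = 1 := by rw [← norm_pow, h5, norm_one]
    exact (pow_eq_one_iff_of_nonneg (norm_nonneg _) (by norm_num)).1 this
  have hn : ∀ i : ℕ, ‖w ^ i * q‖ < 1 := fun i => by simpa [hwn] using hq
  have hr : ∀ r : ℕ, r < 4 → ∏ i ∈ Finset.range 5, qpoch (w ^ i * q * (w ^ i * q) ^ r) (q ^ 5)
      = qpoch (q ^ (5 * (r + 1))) (q ^ 25) := by
    intro r hr
    have hw' : (w ^ (r + 1)) ^ 4 + (w ^ (r + 1)) ^ 3 + (w ^ (r + 1)) ^ 2 + w ^ (r + 1) + 1 = 0 := by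
      interval_cases r
      · simpa using hw
      · linear_combination hw + (w ^ 3 + w) * h5
      · linear_combination hw + (w ^ 7 + w ^ 2 + w ^ 4 + w) * h5
      · linear_combination hw + (w ^ 11 + w ^ 6 + w + w ^ 7 + w ^ 2 + w ^ 3) * h5
    have := qp_roots (q ^ (r + 1)) (norm_pow_lt hq (m := 5) (by norm_num)) _ hw'
    rw [← pow_mul, ← pow_mul, mul_comm (r + 1)] at this
    rw [← this]
    refine Finset.prod_congr rfl fun i _ => ?_
    congr 1
    ring
  have h1 : ∀ i ∈ Finset.range 5, qpoch (w ^ i * q) (w ^ i * q) =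
      ∏ r ∈ Finset.range 5, qpoch (w ^ i * q * (w ^ i * q) ^ r) (q ^ 5) := by
    intro i _
    rw [qp_split _ (hn i) (m := 5) (by norm_num)]
    have : (w ^ i * q) ^ 5 = q ^ 5 := by
      rw [mul_pow, ← pow_mul, mul_comm i, pow_mul, h5, one_pow, one_mul]
    rw [this]
  rw [Finset.prod_congr rfl h1, Finset.prod_comm, Finset.prod_range_succ,
    Finset.prod_congr rfl (fun r hr' => hr r (Finset.mem_range.1 hr'))]
  have h2 : ∏ i ∈ Finset.range 5, qpoch (w ^ i * q * (w ^ i * q) ^ 4) (q ^ 5) =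
      qpoch (q ^ 5) (q ^ 5) ^ 5 := by
    rw [Finset.prod_congr rfl (g := fun _ => qpoch (q ^ 5) (q ^ 5))]
    · simp
    · intro i _
      congr 1
      have : (w ^ i) ^ 5 = 1 := by rw [← pow_mul, mul_comm i, pow_mul, h5, one_pow]
      linear_combination q ^ 5 * this
  rw [h2, qp_split (q ^ 5) (norm_pow_lt hq (m := 5) (by norm_num)) (m := 5) (by norm_num),
    Finset.prod_range_succ _ 4]
  simp only [Finset.prod_range_succ, Finset.prod_range_zero, ← pow_mul, ← pow_add]
  norm_num
  ring


/-- The two-sided theta series. -/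
noncomputable def th (z Q : ℂ) : ℂ := ∑' m : ℤ, z ^ m * Q ^ (m ^ 2)

lemma th_summable {z Q : ℂ} (hz : z ≠ 0) (hQ0 : Q ≠ 0) (hQ : ‖Q‖ < 1) :
    Summable fun m : ℤ => z ^ m * Q ^ (m ^ 2) := by
  have hpi : (Real.pi : ℂ) ≠ 0 := by exact_mod_cast Real.pi_ne_zero
  have h := (summable_jacobiTheta₂_term_iff (Complex.log z / (2 * Real.pi * Complex.I))
    (Complex.log Q / (Real.pi * Complex.I))).2 (by
      have : Complex.log Q / (Real.pi * Complex.I) = -(Complex.I * (Complex.log Q / Real.pi)) := by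
        field_simp
        simp
      rw [this]
      simp only [Complex.neg_im, Complex.I_mul_im, Complex.div_ofReal_re, Complex.log_re]
      have : Real.log ‖Q‖ < 0 := Real.log_neg (norm_pos_iff.2 hQ0) hQ
      have := div_neg_of_neg_of_pos this Real.pi_pos
      linarith)
  refine h.congr fun m => ?_
  rw [jacobiTheta₂_term, Complex.exp_add]
  congr 1
  · rw [show 2 * Real.pi * Complex.I * m * (Complex.log z / (2 * Real.pi * Complex.I)) =
      m * Complex.log z by field_simp, Complex.exp_int_mul, Complex.exp_log hz]
  · rw [show Real.pi * Complex.I * (m : ℂ) ^ 2 * (Complex.log Q / (Real.pi * Complex.I)) =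
      ((m ^ 2 : ℤ) : ℂ) * Complex.log Q by push_cast; field_simp, Complex.exp_int_mul,
      Complex.exp_log hQ0]

/-- Finite Pochhammer product. -/
noncomputable def fp (p : ℂ) (n : ℕ) : ℂ := ∏ k ∈ Finset.range n, (1 - p * p ^ k)

/-- Reciprocal finite Pochhammer products, extended by zero. -/
noncomputable def ec (p : ℂ) (m : ℤ) : ℂ := if 0 ≤ m then (fp p m.toNat)⁻¹ else 0

lemma fp_ne {p : ℂ} (hp : ‖p‖ < 1) (n : ℕ) : fp p n ≠ 0 := by
  refine Finset.prod_ne_zero_iff.2 fun k _ => ?_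
  rw [← pow_succ']
  exact one_sub_ne (norm_pow_lt hp (by simp))

lemma ec_rec {p : ℂ} (hp : ‖p‖ < 1) (m : ℤ) : ec p (m - 1) = (1 - p ^ m) * ec p m := by
  rcases lt_trichotomy m 0 with h | h | h
  · rw [ec, ec, if_neg (by omega), if_neg (by omega), mul_zero]
  · subst h; simp [ec]
  · obtain ⟨n, rfl⟩ : ∃ n : ℕ, m = n + 1 := ⟨(m - 1).toNat, by omega⟩
    have h1 : ((n : ℤ) + 1 - 1) = n := by ring
    have h2 : ((n : ℤ) + 1).toNat = n + 1 := by omega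
    rw [h1, ec, ec, if_pos (by omega), if_pos (by omega), h2, Int.toNat_natCast]
    have h3 : fp p (n + 1) = fp p n * (1 - p * p ^ n) := Finset.prod_range_succ _ _
    have h4 := fp_ne hp n
    have h5 := fp_ne hp (n + 1)
    have h6 : p ^ ((n : ℤ) + 1) = p * p ^ n := by
      rw [← pow_succ']; exact_mod_cast rfl
    rw [h6]
    rw [h3] at h5 ⊢
    have h7 := right_ne_zero_of_mul h5
    field_simp

lemma hasSum_conv {f g : ℤ → ℂ} {a b : ℂ} (h : HasSum g b) (hf : ∀ j, f j = g j) (hab : a = b) :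
    HasSum f a := by
  rw [show f = g from funext hf, hab]
  exact h

lemma jtp_fin {z Q : ℂ} (hz : z ≠ 0) (hQ0 : Q ≠ 0) (hQ : ‖Q‖ < 1) (n : ℕ) :
    HasSum (fun j : ℤ => fp (Q ^ 2) (2 * n) * ec (Q ^ 2) (n + j) * ec (Q ^ 2) (n - j) *
      (z ^ j * Q ^ (j ^ 2)))
      (∏ k ∈ Finset.range n, ((1 + z * Q ^ (2 * k + 1)) * (1 + z⁻¹ * Q ^ (2 * k + 1)))) := by
  have hp := norm_pow_lt hQ two_ne_zero
  induction n with
  | zero =>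
    have := hasSum_single (f := fun j : ℤ => fp (Q ^ 2) (2 * 0) * ec (Q ^ 2) ((0 : ℕ) + j) *
      ec (Q ^ 2) ((0 : ℕ) - j) * (z ^ j * Q ^ (j ^ 2))) 0 (by
        intro j hj
        rcases lt_or_gt_of_ne hj with h | h
        · simp [ec, not_le.2 h]
        · simp [ec, not_le.2 h])
    simpa [ec, fp] using this
  | succ n ih =>
    have hA := ih.mul_left (1 + Q ^ (4 * n + 2))
    have hB := ((Equiv.subRight (1 : ℤ)).hasSum_iff.2 ih).mul_left (z * Q ^ (2 * n + 1))
    have hC := ((Equiv.addRight (1 : ℤ)).hasSum_iff.2 ih).mul_left (z⁻¹ * Q ^ (2 * n + 1))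
    have := (hA.add hB).add hC
    rw [Finset.prod_range_succ]
    refine hasSum_conv this ?_ ?_
    · intro j
      simp only [Function.comp, Equiv.subRight_apply, Equiv.coe_addRight]
      set p := Q ^ 2 with hpdef
      have hp0 : p ≠ 0 := pow_ne_zero 2 hQ0
      have e1 : ec p (n + j) = (1 - p ^ ((n : ℤ) + 1 + j)) * ec p ((n : ℤ) + 1 + j) := by
        rw [← ec_rec hp]; congr 1; ring
      have e2 : ec p (n - j) = (1 - p ^ ((n : ℤ) + 1 - j)) * ec p ((n : ℤ) + 1 - j) := by
        rw [← ec_rec hp]; congr 1; ring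
      have e3 : ec p (n + (j - 1)) = (1 - p ^ ((n : ℤ) + j)) * ec p (n + j) := by
        rw [← ec_rec hp]; congr 1; ring
      have e4 : ec p (n - (j + 1)) = (1 - p ^ ((n : ℤ) - j)) * ec p (n - j) := by
        rw [← ec_rec hp]; congr 1; ring
      have e5 : ec p (n - (j - 1)) = ec p ((n : ℤ) + 1 - j) := by congr 1; ring
      have e6 : ec p (n + (j + 1)) = ec p ((n : ℤ) + 1 + j) := by congr 1; ring
      rw [e3, e4, e5, e6, e1, e2]
      have f1 : fp p (2 * (n + 1)) = fp p (2 * n) * (1 - p * p ^ (2 * n)) * (1 - p * p ^ (2 * n + 1)) := by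
        rw [show 2 * (n + 1) = 2 * n + 1 + 1 by ring, fp, fp, Finset.prod_range_succ,
          Finset.prod_range_succ]
      rw [f1]
      push_cast
      generalize ec p ((n : ℤ) + 1 + j) = E
      generalize ec p ((n : ℤ) + 1 - j) = E'
      have hpz : ∀ m : ℤ, p ^ m = Q ^ (2 * m) := fun m => by rw [hpdef, zpow_mul]; rfl
      obtain ⟨x, hx⟩ : ∃ x, x = p ^ ((n : ℤ) + j) := ⟨_, rfl⟩
      obtain ⟨y, hy⟩ : ∃ y, y = p ^ ((n : ℤ) - j) := ⟨_, rfl⟩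
      have g1 : p ^ ((n : ℤ) + 1 + j) = x * p := by
        rw [hx, ← zpow_add_one₀ hp0]; congr 1; ring
      have g2 : p ^ ((n : ℤ) + 1 - j) = y * p := by
        rw [hy, ← zpow_add_one₀ hp0]; congr 1; ring
      have g3 : p ^ (2 * n) = x * y := by
        rw [hx, hy, ← zpow_add₀ hp0, ← zpow_natCast]; congr 1; push_cast; ring
      have g4 : z * Q ^ (2 * n + 1) * (z ^ (j - 1) * Q ^ ((j - 1) ^ 2)) = y * p * (z ^ j * Q ^ (j ^ 2)) := by
        rw [← g2, hpz, zpow_sub_one₀ hz, ← zpow_natCast Q,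
          show z * Q ^ ((2 * n + 1 : ℕ) : ℤ) * (z ^ j * z⁻¹ * Q ^ ((j - 1) ^ 2)) =
          (z * z⁻¹) * z ^ j * (Q ^ ((2 * n + 1 : ℕ) : ℤ) * Q ^ ((j - 1) ^ 2)) by ring,
          ← zpow_add₀ hQ0, mul_inv_cancel₀ hz,
          show Q ^ (2 * ((n : ℤ) + 1 - j)) * (z ^ j * Q ^ (j ^ 2)) =
          z ^ j * (Q ^ (2 * ((n : ℤ) + 1 - j)) * Q ^ (j ^ 2)) by ring, ← zpow_add₀ hQ0, one_mul]
        congr 2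
        push_cast; ring
      have g5 : z⁻¹ * Q ^ (2 * n + 1) * (z ^ (j + 1) * Q ^ ((j + 1) ^ 2)) = x * p * (z ^ j * Q ^ (j ^ 2)) := by
        rw [← g1, hpz, zpow_add_one₀ hz, ← zpow_natCast Q,
          show z⁻¹ * Q ^ ((2 * n + 1 : ℕ) : ℤ) * (z ^ j * z * Q ^ ((j + 1) ^ 2)) =
          (z * z⁻¹) * z ^ j * (Q ^ ((2 * n + 1 : ℕ) : ℤ) * Q ^ ((j + 1) ^ 2)) by ring,
          ← zpow_add₀ hQ0, mul_inv_cancel₀ hz,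
          show Q ^ (2 * ((n : ℤ) + 1 + j)) * (z ^ j * Q ^ (j ^ 2)) =
          z ^ j * (Q ^ (2 * ((n : ℤ) + 1 + j)) * Q ^ (j ^ 2)) by ring, ← zpow_add₀ hQ0, one_mul]
        congr 2
        push_cast; ring
      have g6 : Q ^ (4 * n + 2) = x * y * p := by
        rw [← g3, hpdef]; ring
      rw [g6, g1, g2, ← hx, ← hy, show p * p ^ (2 * n + 1) = p * p * p ^ (2 * n) by ring, g3]
      linear_combination (-(fp p (2 * n)) * ((1 - x) * ((1 - x * p) * E)) * E') * g4 -
        (fp p (2 * n) * E * ((1 - y) * ((1 - y * p) * E'))) * g5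
    · have : z * z⁻¹ = 1 := mul_inv_cancel₀ hz
      linear_combination (∏ k ∈ Finset.range n, ((1 + z * Q ^ (2 * k + 1)) * (1 + z⁻¹ * Q ^ (2 * k + 1)))) * (Q ^ (4 * n + 2)) * this

lemma fp_bdd {p : ℂ} (hp : ‖p‖ < 1) : ∃ M : ℝ, 0 ≤ M ∧ (∀ n, ‖fp p n‖ ≤ M) ∧ ∀ m, ‖ec p m‖ ≤ M := by
  have h1 : Tendsto (fp p) atTop (𝓝 (qpoch p p)) := qp_tendsto p hp
  have h2 : Tendsto (fun n => (fp p n)⁻¹) atTop (𝓝 (qpoch p p)⁻¹) := h1.inv₀ (qp_ne' hp hp)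
  obtain ⟨M1, hM1⟩ := h1.norm.bddAbove_range
  obtain ⟨M2, hM2⟩ := h2.norm.bddAbove_range
  have a1 : ∀ n, ‖fp p n‖ ≤ M1 := fun n => hM1 ⟨n, rfl⟩
  have a2 : ∀ n, ‖(fp p n)⁻¹‖ ≤ M2 := fun n => hM2 ⟨n, rfl⟩
  have h0 : 0 ≤ M1 := (norm_nonneg _).trans (a1 0)
  refine ⟨max M1 M2, h0.trans (le_max_left _ _), fun n => (a1 n).trans (le_max_left _ _), fun m => ?_⟩
  unfold ec
  split_ifs
  · exact (a2 _).trans (le_max_right _ _)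
  · simpa using Or.inl h0

lemma ec_tendsto {p : ℂ} (hp : ‖p‖ < 1) (j : ℤ) :
    Tendsto (fun n : ℕ => ec p (n + j)) atTop (𝓝 (qpoch p p)⁻¹) := by
  have h1 : Tendsto (fp p) atTop (𝓝 (qpoch p p)) := qp_tendsto p hp
  have h2 : Tendsto (fun n => (fp p n)⁻¹) atTop (𝓝 (qpoch p p)⁻¹) := h1.inv₀ (qp_ne' hp hp)
  have h3 : Tendsto (fun n : ℕ => ((n : ℤ) + j).toNat) atTop atTop := by
    refine tendsto_atTop.2 fun b => ?_
    filter_upwards [eventually_ge_atTop (b + j.natAbs)] with n hn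
    omega
  refine (h2.comp h3).congr' ?_
  filter_upwards [eventually_ge_atTop (j.natAbs)] with n hn
  rw [ec, if_pos (by omega)]
  rfl

/-- Jacobi triple product. -/
lemma jtp {z Q : ℂ} (hz : z ≠ 0) (hQ0 : Q ≠ 0) (hQ : ‖Q‖ < 1) :
    th z Q = qpoch (Q ^ 2) (Q ^ 2) * (qpoch (-(z * Q)) (Q ^ 2) * qpoch (-(z⁻¹ * Q)) (Q ^ 2)) := by
  have hp := norm_pow_lt hQ two_ne_zero
  obtain ⟨M, hM0, hM1, hM2⟩ := fp_bdd hp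
  have hne := qp_ne' hp hp
  have h1 : Tendsto (fun n : ℕ => ∑' j : ℤ, fp (Q ^ 2) (2 * n) * ec (Q ^ 2) (n + j) *
      ec (Q ^ 2) (n - j) * (z ^ j * Q ^ (j ^ 2))) atTop
      (𝓝 (∑' j : ℤ, (qpoch (Q ^ 2) (Q ^ 2))⁻¹ * (z ^ j * Q ^ (j ^ 2)))) := by
    refine tendsto_tsum_of_dominated_convergence (bound := fun j : ℤ => M * M * M * ‖z ^ j * Q ^ (j ^ 2)‖)
      ((th_summable hz hQ0 hQ).norm.mul_left _) (fun j => ?_) (Eventually.of_forall fun n j => ?_)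
    · have a1 : Tendsto (fun n : ℕ => fp (Q ^ 2) (2 * n)) atTop (𝓝 (qpoch (Q ^ 2) (Q ^ 2))) :=
        (qp_tendsto _ hp).comp (tendsto_id.const_mul_atTop' (by norm_num))
      have a2 := ec_tendsto hp j
      have a3 := ec_tendsto hp (-j)
      have := ((a1.mul a2).mul a3).mul_const (z ^ j * Q ^ (j ^ 2))
      rw [mul_inv_cancel₀ hne, one_mul] at this
      exact this
    · rw [norm_mul, norm_mul, norm_mul]
      gcongr
      · exact hM1 _
      · exact hM2 _
      · exact hM2 _
  have h2 : Tendsto (fun n : ℕ => ∏ k ∈ Finset.range n, ((1 + z * Q ^ (2 * k + 1)) *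
      (1 + z⁻¹ * Q ^ (2 * k + 1)))) atTop
      (𝓝 (qpoch (-(z * Q)) (Q ^ 2) * qpoch (-(z⁻¹ * Q)) (Q ^ 2))) := by
    refine ((qp_tendsto _ hp).mul (qp_tendsto _ hp)).congr fun n => ?_
    rw [← Finset.prod_mul_distrib]
    exact Finset.prod_congr rfl fun k _ => by ring
  have h3 := tendsto_nhds_unique (h1.congr fun n => (jtp_fin hz hQ0 hQ n).tsum_eq) h2
  rw [tsum_mul_left] at h3
  rw [← h3, mul_inv_cancel_left₀ hne, th]


lemma th_shift {z Q : ℂ} (hz : z ≠ 0) (hQ0 : Q ≠ 0) : th (z * Q ^ 2) Q = z⁻¹ * Q⁻¹ * th z Q := by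
  unfold th
  rw [← tsum_mul_left, ← (Equiv.addRight (1 : ℤ)).tsum_eq fun m : ℤ => z⁻¹ * Q⁻¹ * (z ^ m * Q ^ (m ^ 2))]
  refine tsum_congr fun m => ?_
  simp only [Equiv.coe_addRight]
  rw [mul_zpow, zpow_add_one₀ hz, show (m + 1) ^ 2 = m ^ 2 + 2 * m + 1 by ring, zpow_add_one₀ hQ0,
    zpow_add₀ hQ0, zpow_mul]
  norm_cast
  field_simp

lemma th_inv (z Q : ℂ) : th z⁻¹ Q = th z Q := by
  unfold th
  rw [← (Equiv.neg ℤ).tsum_eq]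
  refine tsum_congr fun m => ?_
  simp

lemma tsum_fin5 {α : Type*} {f : Fin 5 × α → ℂ} (hf : Summable f) :
    ∑' p, f p = ∑ c : Fin 5, ∑' p, f (c, p) := by
  rw [hf.tsum_prod, tsum_fintype]

/-- Rotation equivalence. -/
def rotE : Fin 5 × (ℤ × ℤ) ≃ ℤ × ℤ where
  toFun x := (2 * x.2.1 - x.2.2 + (x.1 : ℕ), x.2.1 + 2 * x.2.2)
  invFun y := (⟨((y.1 - 2 * y.2) % 5).toNat, by omega⟩,
    (y.2 + 2 * ((y.1 - 2 * y.2) / 5), -((y.1 - 2 * y.2) / 5)))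
  left_inv := by
    rintro ⟨⟨c, hc⟩, m, n⟩
    simp only [Prod.mk.injEq, Fin.mk.injEq]
    refine ⟨?_, ?_, ?_⟩ <;> omega
  right_inv := by
    rintro ⟨a, b⟩
    simp only [Prod.mk.injEq]
    refine ⟨?_, ?_⟩ <;> omega

lemma rot {z Q : ℂ} (hz : z ≠ 0) (hQ0 : Q ≠ 0) (hQ : ‖Q‖ < 1) :
    th z Q ^ 2 = ∑ c : Fin 5, z ^ (c : ℕ) * Q ^ ((c : ℕ) ^ 2) *
      (th (z ^ 3 * Q ^ (4 * ((c : ℕ) : ℤ))) (Q ^ 5) * th (z * Q ^ (-2 * ((c : ℕ) : ℤ))) (Q ^ 5)) := by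
  have hs := th_summable hz hQ0 hQ
  have h5 := norm_pow_lt hQ (m := 5) (by norm_num)
  have h50 : Q ^ 5 ≠ 0 := pow_ne_zero _ hQ0
  have hs2 := summable_mul_of_summable_norm hs.norm hs.norm
  rw [sq, th, tsum_mul_tsum_of_summable_norm hs.norm hs.norm, ← rotE.tsum_eq]
  refine (tsum_fin5 (rotE.summable_iff.2 hs2)).trans ?_
  refine Finset.sum_congr rfl fun c _ => ?_
  have s1 := th_summable (z := z ^ 3 * Q ^ (4 * ((c : ℕ) : ℤ)))
    (mul_ne_zero (pow_ne_zero _ hz) (zpow_ne_zero _ hQ0)) h50 h5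
  have s2 := th_summable (z := z * Q ^ (-2 * ((c : ℕ) : ℤ)))
    (mul_ne_zero hz (zpow_ne_zero _ hQ0)) h50 h5
  rw [th, th, tsum_mul_tsum_of_summable_norm s1.norm s2.norm, ← tsum_mul_left]
  refine tsum_congr fun p => ?_
  obtain ⟨m, n⟩ := p
  simp only [rotE, Equiv.coe_fn_mk, Function.comp]
  simp only [← zpow_natCast, mul_zpow, ← zpow_mul]
  have L : ∀ a b c d : ℤ, z ^ a * Q ^ b * (z ^ c * Q ^ d) = z ^ (a + c) * Q ^ (b + d) := by
    intros; rw [zpow_add₀ hz, zpow_add₀ hQ0]; ring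
  have R : ∀ a b c d e f g h : ℤ, z ^ a * Q ^ b * (z ^ c * Q ^ d * Q ^ e * (z ^ f * Q ^ g * Q ^ h)) =
     z ^ (a + c + f) * Q ^ (b + d + e + g + h) := by
    intros; simp only [zpow_add₀ hz, zpow_add₀ hQ0]; ring
  rw [L, R]
  congr 2
  · push_cast; ring
  · push_cast; ring

lemma psi_th {t : ℂ} (h0 : t ≠ 0) (ht : ‖t‖ < 1) :
    th t t ^ 2 = 4 * (th (t ^ 3) (t ^ 5) * th t (t ^ 5)) + t ^ 2 * th (t ^ 5) (t ^ 5) ^ 2 := by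
  obtain ⟨S, hS⟩ : ∃ S : ℤ → ℂ, ∀ n, S n = th (t ^ n) (t ^ 5) := ⟨_, fun _ => rfl⟩
  have hz : ∀ n : ℤ, t ^ n ≠ 0 := fun n => zpow_ne_zero n h0
  have sh : ∀ n, S (n + 10) = (t ^ (n + 5))⁻¹ * S n := by
    intro n
    rw [hS, hS, zpow_add₀ h0]
    have := th_shift (hz n) (pow_ne_zero 5 h0)
    rw [← pow_mul] at this
    refine this.trans ?_
    rw [zpow_add₀ h0, mul_inv]
    rfl
  have ng : ∀ n, S (-n) = S n := by
    intro n; rw [hS, hS, zpow_neg, th_inv]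
  rw [rot h0 h0 ht]
  have e : ∀ c : Fin 5, th (t ^ 3 * t ^ (4 * ((c : ℕ) : ℤ))) (t ^ 5) * th (t * t ^ (-2 * ((c : ℕ) : ℤ))) (t ^ 5)
     = S (3 + 4 * ((c : ℕ) : ℤ)) * S (1 + -2 * ((c : ℕ) : ℤ)) := by
    intro c
    rw [hS, hS, zpow_add₀ h0, zpow_add₀ h0, zpow_one]; rfl
  simp only [e, Fin.sum_univ_five]
  have h1 : th (t ^ 3) (t ^ 5) = S 3 := by rw [hS]; rfl
  have h2 : th t (t ^ 5) = S 1 := by rw [hS, zpow_one]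
  have h3 : th (t ^ 5) (t ^ 5) = S 5 := by rw [hS]; rfl
  rw [h1, h2, h3]
  have a1 := ng 1
  have a3 := ng 3
  have a5 := ng 5
  have a7 := ng 7
  have b7 := sh (-3)
  have b11 := sh 1
  have b15 := sh 5
  have b19 := sh 9
  have b9 := sh (-1)
  norm_num at *
  norm_cast at *
  rw [b19, a7, b9, b15, b11, b7, a1, a3, a5]
  field_simp
  ring

lemma phi_th {t : ℂ} (h0 : t ≠ 0) (ht : ‖t‖ < 1) :
    th (-1) t ^ 2 = th (-1) (t ^ 5) ^ 2 - 4 * t * (th (-t ^ 2) (t ^ 5) * th (-t ^ 4) (t ^ 5)) := by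
  obtain ⟨S, hS⟩ : ∃ S : ℤ → ℂ, ∀ n, S n = th (-t ^ n) (t ^ 5) := ⟨_, fun _ => rfl⟩
  have hz : ∀ n : ℤ, -t ^ n ≠ 0 := fun n => neg_ne_zero.2 (zpow_ne_zero n h0)
  have sh : ∀ n, S (n + 10) = -(t ^ (n + 5))⁻¹ * S n := by
    intro n
    rw [hS, hS, zpow_add₀ h0]
    have := th_shift (hz n) (pow_ne_zero 5 h0)
    rw [← pow_mul, neg_mul] at this
    refine this.trans ?_
    rw [zpow_add₀ h0, mul_inv, inv_neg, neg_mul]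
    rfl
  have ng : ∀ n, S (-n) = S n := by
    intro n; rw [hS, hS, zpow_neg, ← th_inv, inv_neg, inv_inv]
  rw [rot (by norm_num) h0 ht]
  have e : ∀ c : Fin 5, th ((-1) ^ 3 * t ^ (4 * ((c : ℕ) : ℤ))) (t ^ 5) * th ((-1) * t ^ (-2 * ((c : ℕ) : ℤ))) (t ^ 5)
     = S (4 * ((c : ℕ) : ℤ)) * S (-2 * ((c : ℕ) : ℤ)) := by
    intro c
    rw [hS, hS]; norm_num
  simp only [e, Fin.sum_univ_five]
  have h1 : th (-t ^ 2) (t ^ 5) = S 2 := by rw [hS]; rfl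
  have h2 : th (-t ^ 4) (t ^ 5) = S 4 := by rw [hS]; rfl
  have h3 : th (-1) (t ^ 5) = S 0 := by rw [hS]; norm_num
  rw [h1, h2, h3]
  have a2 := ng 2
  have a4 := ng 4
  have a6 := ng 6
  have a8 := ng 8
  have b8 := sh (-2)
  have b12 := sh 2
  have b6 := sh (-4)
  have b16 := sh 6
  norm_num at *
  norm_cast at *
  rw [b16, b12, a6, a8, b6, b8, a2, a4]
  field_simp
  ring


lemma f_neg {q : ℂ} (hq : ‖q‖ < 1) : qpoch q q * qpoch (-q) q = qpoch (q ^ 2) (q ^ 2) := qp_neg q hq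

lemma psi_prod {t : ℂ} (h0 : t ≠ 0) (ht : ‖t‖ < 1) :
    th t t * qpoch (t ^ 2) (t ^ 2) = 2 * qpoch (t ^ 4) (t ^ 4) ^ 2 := by
  have h2 := norm_pow_lt ht (m := 2) (by norm_num)
  rw [jtp h0 h0 ht, inv_mul_cancel₀ h0, qp_succ (-1) h2, ← sq]
  have := f_neg h2
  rw [← pow_mul] at this
  norm_num at this ⊢
  rw [← this]
  ring

lemma phi_prod {t : ℂ} (h0 : t ≠ 0) (ht : ‖t‖ < 1) :
    th (-1) t * qpoch (t ^ 2) (t ^ 2) = qpoch t t ^ 2 := by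
  rw [jtp (by norm_num) h0 ht, qp_split t ht (m := 2) (by norm_num)]
  norm_num [Finset.prod_range_succ]
  ring_nf

lemma pent_prod {t : ℂ} (h0 : t ≠ 0) (ht : ‖t‖ < 1) :
    th (-t) (t ^ 3) = qpoch (t ^ 2) (t ^ 2) := by
  have h2 := norm_pow_lt ht (m := 2) (by norm_num)
  rw [jtp (by simpa) (pow_ne_zero _ h0) (norm_pow_lt ht (by norm_num)),
    qp_split (t ^ 2) h2 (m := 3) (by norm_num)]
  simp only [Finset.prod_range_succ, Finset.prod_range_zero, ← pow_mul, ← pow_add]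
  rw [show -((-t) * t ^ 3) = t ^ 4 by ring, show -((-t)⁻¹ * t ^ 3) = t ^ 2 by field_simp]
  norm_num
  ring

lemma prod1 {t : ℂ} (h0 : t ≠ 0) (ht : ‖t‖ < 1) :
    th (t ^ 3) (t ^ 5) * th t (t ^ 5) * (qpoch (t ^ 2) (t ^ 2) * qpoch (t ^ 20) (t ^ 20)) =
      qpoch (t ^ 4) (t ^ 4) * qpoch (t ^ 10) (t ^ 10) ^ 3 := by
  have h2 := norm_pow_lt ht (m := 2) (by norm_num)
  have h5 := norm_pow_lt ht (m := 5) (by norm_num)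
  have h10 := norm_pow_lt ht (m := 10) (by norm_num)
  rw [jtp (pow_ne_zero _ h0) (pow_ne_zero _ h0) h5, jtp h0 (pow_ne_zero _ h0) h5]
  have e1 := f_neg h2
  have e2 := f_neg h10
  rw [qp_split (-t ^ 2) h2 (m := 5) (by norm_num)] at e1
  simp only [Finset.prod_range_succ, Finset.prod_range_zero, ← pow_mul, ← pow_add, neg_mul] at e1 e2 ⊢
  rw [show (t ^ 3)⁻¹ * t ^ 5 = t ^ 2 by field_simp, show t⁻¹ * t ^ 5 = t ^ 4 by field_simp,
    show t * t ^ 5 = t ^ 6 by ring]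
  norm_num at e1 e2 ⊢
  rw [← e1, ← e2]
  ring

lemma prod2 {t : ℂ} (h0 : t ≠ 0) (ht : ‖t‖ < 1) :
    th (-t ^ 2) (t ^ 5) * th (-t ^ 4) (t ^ 5) * (qpoch (t ^ 2) (t ^ 2) * qpoch (t ^ 5) (t ^ 5)) =
      qpoch t t * qpoch (t ^ 10) (t ^ 10) ^ 3 := by
  have h2 := norm_pow_lt ht (m := 2) (by norm_num)
  have h5 := norm_pow_lt ht (m := 5) (by norm_num)
  have h10 := norm_pow_lt ht (m := 10) (by norm_num)
  rw [jtp (neg_ne_zero.2 (pow_ne_zero _ h0)) (pow_ne_zero _ h0) h5,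
    jtp (neg_ne_zero.2 (pow_ne_zero _ h0)) (pow_ne_zero _ h0) h5,
    qp_split t ht (m := 10) (by norm_num), qp_split (t ^ 2) h2 (m := 5) (by norm_num),
    qp_split (t ^ 5) h5 (m := 2) (by norm_num)]
  simp only [Finset.prod_range_succ, Finset.prod_range_zero, ← pow_mul, ← pow_add, ← pow_succ',
    inv_neg, neg_mul, neg_neg]
  rw [show (t ^ 2)⁻¹ * t ^ 5 = t ^ 3 by field_simp, show (t ^ 4)⁻¹ * t ^ 5 = t by field_simp]
  norm_num
  ring

lemma I1 {q : ℂ} (h0 : q ≠ 0) (hq : ‖q‖ < 1) :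
    qpoch (q ^ 2) (q ^ 2) ^ 4 / qpoch q q ^ 2 - q * qpoch (q ^ 10) (q ^ 10) ^ 4 / qpoch (q ^ 5) (q ^ 5) ^ 2 =
      qpoch (q ^ 2) (q ^ 2) * qpoch (q ^ 5) (q ^ 5) ^ 3 / (qpoch q q * qpoch (q ^ 10) (q ^ 10)) := by
  obtain ⟨t, rfl⟩ : ∃ t, q = t ^ 2 := ⟨_, (Complex.cpow_nat_inv_pow q two_ne_zero).symm⟩
  have ht0 : t ≠ 0 := by rintro rfl; simp at h0
  have ht : ‖t‖ < 1 := by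
    rw [norm_pow] at hq
    exact (pow_lt_one_iff_of_nonneg (norm_nonneg _) two_ne_zero).1 hq
  have hn : ∀ m : ℕ, m ≠ 0 → qpoch (t ^ m) (t ^ m) ≠ 0 := fun m hm =>
    qp_ne' (norm_pow_lt ht hm) (norm_pow_lt ht hm)
  have n2 := hn 2 (by norm_num)
  have n4 := hn 4 (by norm_num)
  have n10 := hn 10 (by norm_num)
  have n20 := hn 20 (by norm_num)
  have a := psi_prod ht0 ht
  have b := psi_prod (pow_ne_zero 5 ht0) (norm_pow_lt ht (m := 5) (by norm_num))
  have c := prod1 ht0 ht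
  have d := psi_th ht0 ht
  simp only [← pow_mul] at *
  norm_num at *
  rw [eq_div_of_mul_eq n2 a, eq_div_of_mul_eq n10 b, eq_div_of_mul_eq (mul_ne_zero n2 n20) c] at d
  linear_combination d / 4

lemma I2 {q : ℂ} (h0 : q ≠ 0) (hq : ‖q‖ < 1) :
    qpoch q q ^ 4 / qpoch (q ^ 2) (q ^ 2) ^ 2 - qpoch (q ^ 5) (q ^ 5) ^ 4 / qpoch (q ^ 10) (q ^ 10) ^ 2 =
      - 4 * q * (qpoch q q * qpoch (q ^ 10) (q ^ 10) ^ 3 / (qpoch (q ^ 2) (q ^ 2) * qpoch (q ^ 5) (q ^ 5))) := by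
  have hn : ∀ m : ℕ, m ≠ 0 → qpoch (q ^ m) (q ^ m) ≠ 0 := fun m hm =>
    qp_ne' (norm_pow_lt hq hm) (norm_pow_lt hq hm)
  have n2 := hn 2 (by norm_num)
  have n5 := hn 5 (by norm_num)
  have n10 := hn 10 (by norm_num)
  have a := phi_prod h0 hq
  have b := phi_prod (pow_ne_zero 5 h0) (norm_pow_lt hq (m := 5) (by norm_num))
  have c := prod2 h0 hq
  have d := phi_th h0 hq
  simp only [← pow_mul] at *
  norm_num at *
  rw [eq_div_of_mul_eq n2 a, eq_div_of_mul_eq n10 b, eq_div_of_mul_eq (mul_ne_zero n2 n5) c] at d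
  linear_combination d

/-- The key eta-quotient identity. -/
lemma keyA {q : ℂ} (h0 : q ≠ 0) (hq : ‖q‖ < 1) (X Y : ℂ → ℂ)
    (hX : ∀ q, X q = q * qpoch (q ^ 5) (q ^ 5) ^ 5 / qpoch q q)
    (hY : ∀ q, Y q = qpoch q q ^ 5 / qpoch (q ^ 5) (q ^ 5)) :
    20 * (X (q ^ 2) ^ 2 / X q) = Y q - Y (q ^ 2) + 5 * X q - 15 * X (q ^ 2) := by
  have hn : ∀ m : ℕ, m ≠ 0 → qpoch (q ^ m) (q ^ m) ≠ 0 := fun m hm =>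
    qp_ne' (norm_pow_lt hq hm) (norm_pow_lt hq hm)
  have n1 := qp_ne' hq hq
  have n2 := hn 2 (by norm_num)
  have n5 := hn 5 (by norm_num)
  have n10 := hn 10 (by norm_num)
  have i1 := I1 h0 hq
  have i2 := I2 h0 hq
  simp only [hX, hY, ← pow_mul]
  norm_num
  generalize qpoch q q = f1 at *
  generalize qpoch (q ^ 2) (q ^ 2) = f2 at *
  generalize qpoch (q ^ 5) (q ^ 5) = f5 at *
  generalize qpoch (q ^ 10) (q ^ 10) = f10 at *
  obtain ⟨s, hs⟩ : ∃ s, s = f2 ^ 4 * f5 ^ 2 / (q * f1 ^ 2 * f10 ^ 4) := ⟨_, rfl⟩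
  obtain ⟨u, hu⟩ : ∃ u, u = f2 * f5 ^ 5 / (q * f1 * f10 ^ 5) := ⟨_, rfl⟩
  obtain ⟨r, hr⟩ : ∃ r, r = f1 ^ 4 * f10 ^ 2 / (f2 ^ 2 * f5 ^ 4) := ⟨_, rfl⟩
  obtain ⟨x, hx⟩ : ∃ x, x = q * f5 ^ 5 / f1 := ⟨_, rfl⟩
  have hu0 : u ≠ 0 := by
    rw [hu]; positivity
  have hx0 : x ≠ 0 := by
    rw [hx]; positivity
  have e1 : s = u + 1 := by
    have : s - 1 = (f2 ^ 4 / f1 ^ 2 - q * f10 ^ 4 / f5 ^ 2) * (f5 ^ 2 / (q * f10 ^ 4)) := by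
      rw [hs]; field_simp
    rw [i1] at this
    rw [← sub_eq_iff_eq_add, this, hu]
    field_simp
  have e2 : r = 1 - 4 / u := by
    have : r - 1 = (f1 ^ 4 / f2 ^ 2 - f5 ^ 4 / f10 ^ 2) * (f10 ^ 2 / f5 ^ 4) := by
      rw [hr]; field_simp
    rw [i2] at this
    have h : r - 1 = - (4 / u) := by
      rw [this, hu]
      field_simp
    linear_combination h
  have g1 : q ^ 2 * f10 ^ 5 / f2 = x / u := by
    rw [hx, hu]; field_simp
  have g2 : f1 ^ 5 / f5 = x * (s * r ^ 2) := by
    rw [hx, hs, hr]; field_simp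
  have g3 : f2 ^ 5 / f10 = x * (s ^ 2 * r / u) := by
    rw [hx, hs, hr, hu]; field_simp
  rw [g1, g2, g3, ← hx, e2, e1]
  field_simp
  ring


/-- Term of the pentagonal series. -/
noncomputable def pt (t : ℂ) (m : ℤ) : ℂ := (-t) ^ m * (t ^ 3) ^ (m ^ 2)

/-- Residue class sums. -/
noncomputable def DD (t : ℂ) (r : ℕ) : ℂ := ∑' k : ℤ, pt t (5 * k + r)

lemma pt_eq {t : ℂ} (h0 : t ≠ 0) (m : ℤ) : pt t m = (-1) ^ m * t ^ (3 * m ^ 2 + m) := by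
  rw [pt, neg_eq_neg_one_mul t, mul_zpow, zpow_add₀ h0, zpow_mul]
  norm_cast
  ring

lemma pt_summable {t : ℂ} (h0 : t ≠ 0) (ht : ‖t‖ < 1) : Summable (pt t) :=
  th_summable (neg_ne_zero.2 h0) (pow_ne_zero 3 h0) (norm_pow_lt ht (by norm_num))

lemma inj5 (r : ℕ) : Function.Injective fun k : ℤ => 5 * k + (r : ℤ) := fun a b h => by
  simp only at h; omega

/-- Residue splitting. -/
def splE : Fin 5 × ℤ ≃ ℤ where
  toFun x := 5 * x.2 + (x.1 : ℕ)
  invFun m := (⟨(m % 5).toNat, by omega⟩, m / 5)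
  left_inv := by
    rintro ⟨⟨c, hc⟩, m⟩
    simp only [Prod.mk.injEq, Fin.mk.injEq]
    refine ⟨?_, ?_⟩ <;> omega
  right_inv := by
    intro a
    simp only
    omega

lemma pent_split {t : ℂ} (h0 : t ≠ 0) (ht : ‖t‖ < 1) :
    qpoch (t ^ 2) (t ^ 2) = DD t 0 + DD t 1 + DD t 2 + DD t 3 + DD t 4 := by
  rw [← pent_prod h0 ht]
  have := tsum_fin5 (splE.summable_iff.2 (pt_summable h0 ht))
  rw [Fin.sum_univ_five] at this
  refine Eq.trans ?_ this
  exact (splE.tsum_eq (pt t)).symm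

lemma DD_rot {t : ℂ} (h0 : t ≠ 0) (ζ : ℂ) (hζ : ζ ^ 5 = 1) (r : ℕ) :
    DD (ζ * t) r = ζ ^ (3 * r ^ 2 + r) * DD t r := by
  have hz0 : ζ ≠ 0 := by rintro rfl; simp at hζ
  rw [DD, DD, ← tsum_mul_left]
  refine tsum_congr fun k => ?_
  rw [pt_eq h0, pt_eq (mul_ne_zero hz0 h0), mul_zpow,
    show 3 * (5 * k + (r : ℤ)) ^ 2 + (5 * k + (r : ℤ)) =
      5 * (15 * k ^ 2 + 6 * k * r + k) + ((3 * r ^ 2 + r : ℕ) : ℤ) by push_cast; ring,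
    zpow_add₀ hz0, zpow_mul, zpow_natCast]
  have : ζ ^ (5 : ℤ) = 1 := by exact_mod_cast hζ
  rw [this, one_zpow]
  ring

lemma DD_four {t : ℂ} (h0 : t ≠ 0) (ht : ‖t‖ < 1) :
    DD t 4 = - t ^ 2 * qpoch (t ^ 50) (t ^ 50) := by
  have := pent_prod (pow_ne_zero 25 h0) (norm_pow_lt ht (m := 25) (by norm_num))
  rw [← pow_mul, ← pow_mul] at this
  norm_num at this
  rw [← this, th, ← tsum_mul_left, DD, ← ((Equiv.neg ℤ).trans (Equiv.subRight (1 : ℤ))).tsum_eq]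
  refine tsum_congr fun k => ?_
  have e := pt_eq (pow_ne_zero 25 h0) k
  rw [pt, ← pow_mul] at e
  norm_num at e
  rw [e, pt_eq h0]
  simp only [Equiv.trans_apply, Equiv.neg_apply, Equiv.subRight_apply]
  push_cast
  rw [show (5 * (-k - 1) + 4 : ℤ) = (-5) * k - 1 by ring, zpow_sub_one₀ (by norm_num), zpow_mul,
    show 3 * ((-5) * k - 1) ^ 2 + ((-5) * k - 1) = 25 * (3 * k ^ 2 + k) + 2 by ring, zpow_add₀ h0, zpow_mul]
  norm_num
  norm_cast
  ring

/-- Auxiliary equivalence. -/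
def shE : Fin 5 × (ℤ × ℤ) ≃ ℤ × ℤ where
  toFun x := (5 * x.2.1 + (x.1 : ℕ), x.2.2 - 2 * x.2.1 - ((2 * (x.1 : ℕ) + 1) / 5 : ℕ))
  invFun y := (⟨(y.1 % 5).toNat, by omega⟩,
    (y.1 / 5, y.2 + 2 * (y.1 / 5) + ((2 * (y.1 % 5).toNat + 1) / 5 : ℕ)))
  left_inv := by
    rintro ⟨⟨c, hc⟩, m, n⟩
    simp only [Prod.mk.injEq, Fin.mk.injEq]
    refine ⟨?_, ?_, ?_⟩ <;> omega
  right_inv := by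
    rintro ⟨a, b⟩
    simp only [Prod.mk.injEq]
    refine ⟨?_, ?_⟩ <;> omega

/-- Reflection. -/
def reE : ℤ × ℤ ≃ ℤ × ℤ where
  toFun x := (-x.1 - 1 - 4 * x.2, x.2)
  invFun x := (-x.1 - 1 - 4 * x.2, x.2)
  left_inv := by rintro ⟨a, b⟩; exact Prod.ext (by simp only; ring) rfl
  right_inv := by rintro ⟨a, b⟩; exact Prod.ext (by simp only; ring) rfl

lemma gen_summ (p : ℤ → ℂ) (hs2 : Summable fun x : ℤ × ℤ => p x.1 * p x.2)
    (h : Function.Injective fun x : ℤ × ℤ => (x.1, 2 * x.1 + 1 + 5 * x.2)) :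
    Summable fun x : ℤ × ℤ => p x.1 * p (2 * x.1 + 1 + 5 * x.2) := by
  have := hs2.comp_injective h
  simpa only [Function.comp_def] using this

lemma DD_rel {t : ℂ} (h0 : t ≠ 0) (ht : ‖t‖ < 1) :
    (DD t 0 + DD t 3) * (DD t 1 + DD t 2) = - DD t 4 ^ 2 := by
  have hs := pt_summable h0 ht
  have hs2 := summable_mul_of_summable_norm hs.norm hs.norm
  obtain ⟨g, hg⟩ : ∃ g : ℤ × ℤ → ℂ, g = fun x => pt t x.1 * pt t (2 * x.1 + 1 + 5 * x.2) := ⟨_, rfl⟩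
  have hgs : Summable g := by
    have : Function.Injective fun x : ℤ × ℤ => (x.1, 2 * x.1 + 1 + 5 * x.2) := by
      rintro ⟨a, b⟩ ⟨c, d⟩ h
      simp only [Prod.mk.injEq] at h ⊢
      omega
    rw [hg]
    exact gen_summ (pt t) hs2 this
  have z1 : ∑' x, g x = 0 := by
    have h1 := reE.tsum_eq g
    have h2 : ∑' x, g (reE x) = - ∑' x, g x := by
      rw [← tsum_neg]
      refine tsum_congr fun x => ?_
      obtain ⟨m, l⟩ := x
      rw [hg]
      simp only [reE, Equiv.coe_fn_mk]
      have L : ∀ a b : ℤ, pt t a * pt t b = (-1) ^ (a + b) * t ^ (3 * a ^ 2 + a + (3 * b ^ 2 + b)) := by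
        intro a b
        rw [pt_eq h0, pt_eq h0, zpow_add₀ h0 (3 * a ^ 2 + a), zpow_add₀ (by norm_num) a b]; ring
      rw [L, L]
      have E1 : (-1 : ℂ) ^ (-m - 1 - 4 * l + (2 * (-m - 1 - 4 * l) + 1 + 5 * l)) =
          - (-1) ^ (m + (2 * m + 1 + 5 * l)) := by
        rw [show -m - 1 - 4 * l + (2 * (-m - 1 - 4 * l) + 1 + 5 * l) =
          (m + (2 * m + 1 + 5 * l)) + 1 + 2 * (-3 * m - 2 - 6 * l) by ring, zpow_add₀ (by norm_num),
          zpow_add_one₀ (by norm_num), zpow_mul]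
        norm_num
      rw [E1, neg_mul]
      congr 3
      ring
    have : (2 : ℂ) * ∑' x, g x = 0 := by linear_combination h2 - h1
    simpa using this
  have z2 := tsum_fin5 (shE.summable_iff.2 hgs)
  have z3 : ∑' p, (g ∘ shE) p = ∑' x, g x := shE.tsum_eq g
  rw [z3, z1] at z2
  have sr : ∀ r : ℕ, Summable fun k : ℤ => ‖pt t (5 * k + r)‖ := fun r => hs.norm.comp_injective (inj5 r)
  have z4 : ∀ c : Fin 5, ∑' p, (g ∘ shE) (c, p) = DD t c * DD t ((2 * c + 1) % 5) := by
    intro c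
    rw [DD, DD, tsum_mul_tsum_of_summable_norm (sr _) (sr _)]
    refine tsum_congr fun p => ?_
    obtain ⟨k, k'⟩ := p
    rw [hg]
    simp only [Function.comp, shE, Equiv.coe_fn_mk]
    congr 2
    omega
  simp only [z4, Fin.sum_univ_five] at z2
  norm_num at z2
  linear_combination -z2

lemma dissect {t : ℂ} (h0 : t ≠ 0) (ht : ‖t‖ < 1) : ∃ A B C : ℂ, A * C = - B ^ 2 ∧
    B = - t ^ 2 * qpoch (t ^ 50) (t ^ 50) ∧
    ∀ ζ : ℂ, ζ ^ 5 = 1 → qpoch ((ζ * t) ^ 2) ((ζ * t) ^ 2) = A + ζ ^ 2 * B + ζ ^ 4 * C := by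
  refine ⟨DD t 0 + DD t 3, DD t 4, DD t 1 + DD t 2, DD_rel h0 ht, DD_four h0 ht, fun ζ hζ => ?_⟩
  have hz0 : ζ ≠ 0 := by rintro rfl; simp at hζ
  have hn : ‖ζ‖ = 1 := by
    have : ‖ζ‖ ^ 5 = 1 := by rw [← norm_pow, hζ, norm_one]
    exact (pow_eq_one_iff_of_nonneg (norm_nonneg _) (by norm_num)).1 this
  rw [pent_split (mul_ne_zero hz0 h0) (by simpa [hn] using ht)]
  simp only [DD_rot h0 ζ hζ]
  norm_num
  have e14 : ζ ^ 14 = ζ ^ 4 := by linear_combination ζ ^ 4 * (ζ ^ 5 + 1) * hζ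
  have e30 : ζ ^ 30 = 1 := by rw [show 30 = 5 * 6 by norm_num, pow_mul, hζ, one_pow]
  have e52 : ζ ^ 52 = ζ ^ 2 := by rw [show 52 = 5 * 10 + 2 by norm_num, pow_add, pow_mul, hζ, one_pow, one_mul]
  rw [e14, e30, e52]
  ring


lemma norm_poly (A B C w : ℂ) (hw : w ^ 4 + w ^ 3 + w ^ 2 + w + 1 = 0) (hA : A ≠ 0)
    (h : A * C = -B ^ 2) :
    (A + B + C) * (A + w * B + w ^ 2 * C) * (A + w ^ 2 * B + w ^ 4 * C) *
      (A + w ^ 3 * B + w ^ 6 * C) * (A + w ^ 4 * B + w ^ 8 * C) = A ^ 5 + 11 * B ^ 5 + C ^ 5 := by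
  have h5 : w ^ 5 = 1 := by linear_combination (w - 1) * hw
  obtain ⟨a, ha⟩ : ∃ a, a = w + w ^ 4 := ⟨_, rfl⟩
  have hb : w ^ 2 + w ^ 3 = -1 - a := by rw [ha]; linear_combination hw
  have haa : a ^ 2 = 1 - a := by
    rw [ha]; linear_combination (2 + w ^ 3) * h5 + hw
  have p1 : (A + w * B + w ^ 2 * C) * (A + w ^ 4 * B + w ^ 8 * C) =
      A ^ 2 + B ^ 2 + C ^ 2 + a * (A * B + B * C) + (-1 - a) * (A * C) := by
    rw [← hb, ha]
    linear_combination (B ^ 2 + A * C * w ^ 3 + B * C * w ^ 4 + B * C * w + C ^ 2 * (w ^ 5 + 1)) * h5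
  have p2 : (A + w ^ 2 * B + w ^ 4 * C) * (A + w ^ 3 * B + w ^ 6 * C) =
      A ^ 2 + B ^ 2 + C ^ 2 + (-1 - a) * (A * B + B * C) + a * (A * C) := by
    rw [← hb, ha]
    linear_combination (B ^ 2 + A * C * w + B * C * w ^ 3 + B * C * w ^ 2 + C ^ 2 * (w ^ 5 + 1)) * h5
  have e : (A + B + C) * (A + w * B + w ^ 2 * C) * (A + w ^ 2 * B + w ^ 4 * C) *
      (A + w ^ 3 * B + w ^ 6 * C) * (A + w ^ 4 * B + w ^ 8 * C) =
      (A + B + C) * ((A + w * B + w ^ 2 * C) * (A + w ^ 4 * B + w ^ 8 * C)) *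
      ((A + w ^ 2 * B + w ^ 4 * C) * (A + w ^ 3 * B + w ^ 6 * C)) := by ring
  rw [e, p1, p2]
  have e2 : (A ^ 2 + B ^ 2 + C ^ 2 + a * (A * B + B * C) + (-1 - a) * (A * C)) *
      (A ^ 2 + B ^ 2 + C ^ 2 + (-1 - a) * (A * B + B * C) + a * (A * C)) =
      (A ^ 2 + B ^ 2 + C ^ 2) ^ 2 - (A ^ 2 + B ^ 2 + C ^ 2) * ((A * B + B * C) + A * C)
      + 3 * (A * B + B * C) * (A * C) - (A * B + B * C) ^ 2 - (A * C) ^ 2 := by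
    linear_combination (2 * (A * B + B * C) * (A * C) - (A * B + B * C) ^ 2 - (A * C) ^ 2) * haa
  rw [mul_assoc, e2]
  have hC : C = -B ^ 2 / A := by field_simp; linear_combination h
  rw [hC]
  field_simp
  ring

lemma G_poly (A B C x N : ℂ) (hx : x ^ 5 = 1) (hA : A ≠ 0) (h : A * C = -B ^ 2)
    (hN : N = A ^ 5 + 11 * B ^ 5 + C ^ 5) :
    (A + x * B + x ^ 2 * C) ^ 5 * (A + x * B + x ^ 2 * C) - 5 * x * B * N =
    (A + x * B + x ^ 2 * C) * ((A ^ 5 - 14 * B ^ 5 + C ^ 5) + (10 * A ^ 3 * B ^ 2 - 20 * B ^ 3 * C ^ 2) * x ^ 2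
      + (-20 * A ^ 2 * B ^ 3 + 10 * B ^ 2 * C ^ 3) * x ^ 3) := by
  obtain ⟨M, hM⟩ : ∃ M, M = A ^ 4 + x ^ 8 * C ^ 4 + 2 * x ^ 2 * A ^ 2 * B ^ 2 + 5 * x ^ 4 * B ^ 4
    + 2 * x ^ 6 * B ^ 2 * C ^ 2 - x * A ^ 3 * B - x ^ 7 * B * C ^ 3 - 3 * x ^ 3 * A * B ^ 3
    - 3 * x ^ 5 * B ^ 3 * C := ⟨_, rfl⟩
  have hC : C = -B ^ 2 / A := by field_simp; linear_combination h
  have m1 : (A + x * B + x ^ 2 * C) * M = A ^ 5 + 11 * B ^ 5 * x ^ 5 + C ^ 5 * x ^ 10 := by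
    rw [hM, hC]; field_simp; ring
  have m2 : (A + x * B + x ^ 2 * C) ^ 5 - 5 * x * B * M = A ^ 5 + 10 * A ^ 3 * B ^ 2 * x ^ 2
      - 20 * A ^ 2 * B ^ 3 * x ^ 3 - 14 * B ^ 5 * x ^ 5 - 20 * B ^ 3 * C ^ 2 * x ^ 7
      + 10 * B ^ 2 * C ^ 3 * x ^ 8 + C ^ 5 * x ^ 10 := by
    rw [hM, hC]; field_simp; ring
  have m1' : (A + x * B + x ^ 2 * C) * M = N := by
    rw [m1, hN]; linear_combination (11 * B ^ 5 + C ^ 5 * (x ^ 5 + 1)) * hx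
  have m2' : (A + x * B + x ^ 2 * C) ^ 5 - 5 * x * B * M =
      (A ^ 5 - 14 * B ^ 5 + C ^ 5) + (10 * A ^ 3 * B ^ 2 - 20 * B ^ 3 * C ^ 2) * x ^ 2
      + (-20 * A ^ 2 * B ^ 3 + 10 * B ^ 2 * C ^ 3) * x ^ 3 := by
    rw [m2]
    linear_combination (-14 * B ^ 5 - 20 * B ^ 3 * C ^ 2 * x ^ 2 + 10 * B ^ 2 * C ^ 3 * x ^ 3
      + C ^ 5 * (x ^ 5 + 1)) * hx
  rw [← m2', ← m1']
  ring

lemma H_dissect {q : ℂ} (h0 : q ≠ 0) (hq : ‖q‖ < 1) (X Y : ℂ → ℂ)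
    (hX : ∀ q, X q = q * qpoch (q ^ 5) (q ^ 5) ^ 5 / qpoch q q)
    (hY : ∀ q, Y q = qpoch q q ^ 5 / qpoch (q ^ 5) (q ^ 5)) (w : ℂ)
    (hw : w ^ 4 + w ^ 3 + w ^ 2 + w + 1 = 0) :
    ∃ g0 g2 g3 : ℂ, ∀ i : ℕ, Y (w ^ i * q) + 5 * X (w ^ i * q) =
      g0 + g2 * (w ^ i) ^ 2 + g3 * (w ^ i) ^ 3 := by
  have h5 : w ^ 5 = 1 := by linear_combination (w - 1) * hw
  have hwn : ‖w‖ = 1 := by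
    have : ‖w‖ ^ 5 = 1 := by rw [← norm_pow, h5, norm_one]
    exact (pow_eq_one_iff_of_nonneg (norm_nonneg _) (by norm_num)).1 this
  obtain ⟨t, rfl⟩ : ∃ t : ℂ, q = t ^ 2 := ⟨q ^ (1 / 2 : ℂ), by
    rw [← Complex.cpow_nat_mul]; norm_num⟩
  have t0 : t ≠ 0 := by rintro rfl; simp at h0
  have ht : ‖t‖ < 1 := by
    rw [norm_pow] at hq
    exact (pow_lt_one_iff_of_nonneg (norm_nonneg _) (by norm_num)).1 hq
  obtain ⟨A, B, C, hAC, hB, hP⟩ := dissect t0 ht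
  have hf25 : qpoch (t ^ 50) (t ^ 50) ≠ 0 :=
    qp_ne' (norm_pow_lt ht (by norm_num)) (norm_pow_lt ht (by norm_num))
  have hf5 : qpoch (t ^ 10) (t ^ 10) ≠ 0 :=
    qp_ne' (norm_pow_lt ht (by norm_num)) (norm_pow_lt ht (by norm_num))
  have hB0 : B ≠ 0 := by
    rw [hB]; exact mul_ne_zero (neg_ne_zero.2 (pow_ne_zero 2 t0)) hf25
  have hA : A ≠ 0 := by
    rintro rfl
    simp at hAC
    exact hB0 hAC
  have hPi : ∀ i : ℕ, qpoch (w ^ i * t ^ 2) (w ^ i * t ^ 2) =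
      A + w ^ i * B + (w ^ i) ^ 2 * C := by
    intro i
    have hx : (w ^ i) ^ 5 = 1 := by rw [← pow_mul, mul_comm, pow_mul, h5, one_pow]
    have := hP ((w ^ i) ^ 3) (by rw [← pow_mul, mul_comm, pow_mul, hx, one_pow])
    generalize w ^ i = x at *
    have e1 : (x ^ 3 * t) ^ 2 = x * t ^ 2 := by linear_combination x * t ^ 2 * hx
    have e2 : (x ^ 3) ^ 2 = x := by linear_combination x * hx
    have e3 : (x ^ 3) ^ 4 = x ^ 2 := by linear_combination x ^ 2 * (x ^ 5 + 1) * hx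
    rwa [e1, e2, e3] at this
  have hn := qp_norm hq w hw
  simp only [hPi, Finset.prod_range_succ, Finset.prod_range_zero, ← pow_mul] at hn
  norm_num at hn
  rw [norm_poly A B C w hw hA hAC] at hn
  refine ⟨(A ^ 5 - 14 * B ^ 5 + C ^ 5) / qpoch (t ^ 10) (t ^ 10),
    (10 * A ^ 3 * B ^ 2 - 20 * B ^ 3 * C ^ 2) / qpoch (t ^ 10) (t ^ 10),
    (-20 * A ^ 2 * B ^ 3 + 10 * B ^ 2 * C ^ 3) / qpoch (t ^ 10) (t ^ 10), fun i => ?_⟩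
  have hx : (w ^ i) ^ 5 = 1 := by rw [← pow_mul, mul_comm, pow_mul, h5, one_pow]
  have hPne : qpoch (w ^ i * t ^ 2) (w ^ i * t ^ 2) ≠ 0 := by
    have : ‖w ^ i * t ^ 2‖ < 1 := by rw [norm_mul, norm_pow, hwn, one_pow, one_mul]; exact hq
    exact qp_ne' this this
  rw [hX, hY, show (w ^ i * t ^ 2) ^ 5 = t ^ 10 by rw [mul_pow, hx]; ring]
  rw [hPi] at hPne ⊢
  have hg := G_poly A B C (w ^ i) _ hx hA hAC rfl
  generalize w ^ i = x at *
  generalize qpoch (t ^ 50) (t ^ 50) = u at *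
  generalize qpoch (t ^ 10) (t ^ 10) = v at *
  field_simp
  linear_combination hg - 5 * x * t ^ 2 * hn + 5 * x * (A ^ 5 + 11 * B ^ 5 + C ^ 5) * hB


lemma psiNeg_neg {q : ℂ} (hq : ‖q‖ < 1) :
    psiNeg (-q) = qpoch (q ^ 2) (q ^ 2) ^ 2 / qpoch q q := by
  have h2 := norm_pow_lt hq (m := 2) (by norm_num)
  have h4 := norm_pow_lt hq (m := 4) (by norm_num)
  have a1 := qp_split (-q) (q := -q) (by simpa using hq) (m := 2) (by norm_num)
  have a2 := qp_split q hq (m := 2) (by norm_num)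
  have a3 := qp_split (q ^ 2) h2 (m := 2) (by norm_num)
  have a4 := qp_neg q h2
  simp only [Finset.prod_range_succ, Finset.prod_range_zero, one_mul, pow_zero, mul_one, pow_one,
    ← pow_mul, ← sq] at a1 a2 a3 a4
  norm_num [← sq] at a1 a2 a3 a4
  have n1 := qp_ne' hq hq
  have n2 := qp_ne' h2 h2
  have n4 := qp_ne' h4 h4
  have e4 : (-q) ^ 4 = q ^ 4 := by ring
  have e22 : q ^ 2 * q ^ 2 = q ^ 4 := by ring
  rw [psiNeg, e4, neg_sq, a1, div_eq_div_iff n2 n1]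
  have : qpoch q q * qpoch (-q) (q ^ 2) * qpoch (q ^ 4) (q ^ 4) = qpoch (q ^ 2) (q ^ 2) ^ 2 := by
    rw [a2]
    calc _ = (qpoch q (q ^ 2) * qpoch (-q) (q ^ 2)) * qpoch (q ^ 4) (q ^ 4) * qpoch (q ^ 2) (q ^ 2) := by ring
      _ = (qpoch (q ^ 2) (q ^ 4) * qpoch (q ^ 4) (q ^ 4)) * qpoch (q ^ 2) (q ^ 2) := by rw [a4]
      _ = _ := by rw [← a3]; ring
  linear_combination qpoch (q ^ 2) (q ^ 2) * this

lemma psiNeg_ne {q : ℂ} (hq : ‖q‖ < 1) : psiNeg q ≠ 0 := by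
  have h2 := norm_pow_lt hq (m := 2) (by norm_num)
  have h4 := norm_pow_lt hq (m := 4) (by norm_num)
  exact div_ne_zero (mul_ne_zero (qp_ne' hq hq) (qp_ne' h4 h4)) (qp_ne' h2 h2)

lemma F_eq {q : ℂ} (h0 : q ≠ 0) (hq : ‖q‖ < 1) (X : ℂ → ℂ)
    (hX : ∀ q, X q = q * qpoch (q ^ 5) (q ^ 5) ^ 5 / qpoch q q) :
    q ^ 3 * (psiNeg ((-q) ^ 5) ^ 5 / psiNeg (-q)) = X (q ^ 2) ^ 2 / X q := by
  have h2 := norm_pow_lt hq (m := 2) (by norm_num)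
  have h5 := norm_pow_lt hq (m := 5) (by norm_num)
  have h10 := norm_pow_lt hq (m := 10) (by norm_num)
  have n1 := qp_ne' hq hq
  have n2 := qp_ne' h2 h2
  have n5 := qp_ne' h5 h5
  have n10 := qp_ne' h10 h10
  rw [show (-q) ^ 5 = -(q ^ 5) by ring, psiNeg_neg hq, psiNeg_neg h5, hX, hX]
  simp only [← pow_mul]
  norm_num
  field_simp

lemma ps_unique (c : ℕ → ℂ) (hs : ∀ q : ℂ, ‖q‖ < 1 → Summable fun n => c n * q ^ n)
    (hz : ∀ q : ℂ, ‖q‖ < 1 → q ≠ 0 → ∑' n, c n * q ^ n = 0) (n : ℕ) : c n = 0 := by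
  have hf : HasFPowerSeriesAt (fun q : ℂ => ∑' n, c n * q ^ n)
      (FormalMultilinearSeries.ofScalars ℂ c) 0 := by
    rw [hasFPowerSeriesAt_iff]
    filter_upwards [Metric.ball_mem_nhds (0 : ℂ) one_pos] with z hz
    have := (hs z (by simpa using hz)).hasSum
    simpa [FormalMultilinearSeries.coeff_ofScalars, mul_comm] using this
  have ev : ∀ᶠ q in 𝓝[≠] (0 : ℂ), (fun q : ℂ => ∑' n, c n * q ^ n) q = 0 := by
    filter_upwards [self_mem_nhdsWithin,
      mem_nhdsWithin_of_mem_nhds (Metric.ball_mem_nhds (0 : ℂ) one_pos)] with q h1 h2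
    exact hz q (by simpa using h2) h1
  have ev2 := (hf.analyticAt.frequently_zero_iff_eventually_zero).1 ev.frequently
  have := hf.eq_zero_of_eventually ev2
  have h3 := FormalMultilinearSeries.coeff_ofScalars (p := c) (n := n)
  rw [← h3, this]
  rfl

lemma main_vanish (a : ℕ → ℂ)
    (ha : ∀ q : ℂ, ‖q‖ < 1 → ∑' n : ℕ, a n * q ^ n = psiNeg ((-q) ^ 5) ^ 5 / psiNeg (-q))
    (w : ℂ) (hw : w ^ 4 + w ^ 3 + w ^ 2 + w + 1 = 0) (e : ℕ)
    (he : ∀ k ∈ ({e, e + 2, e + 3} : Finset ℕ), ∑ i ∈ Finset.range 5, (w ^ i) ^ k = 0) (n : ℕ) :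
    a n * (1 + (-1) ^ n) * ∑ i ∈ Finset.range 5, (w ^ i) ^ (e + 3 + n) = 0 := by
  have h5 : w ^ 5 = 1 := by linear_combination (w - 1) * hw
  have hwn : ‖w‖ = 1 := by
    have : ‖w‖ ^ 5 = 1 := by rw [← norm_pow, h5, norm_one]
    exact (pow_eq_one_iff_of_nonneg (norm_nonneg _) (by norm_num)).1 this
  have hw0 : w ≠ 0 := by rintro rfl; simp at hwn
  have hsum : ∀ q : ℂ, ‖q‖ < 1 → Summable fun n => a n * q ^ n := by
    intro q hq
    by_contra hcon
    have h1 := ha q hq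
    rw [tsum_eq_zero_of_not_summable hcon] at h1
    have hq' : ‖-q‖ < 1 := by simpa using hq
    exact (div_ne_zero (pow_ne_zero 5 (psiNeg_ne (norm_pow_lt hq' (m := 5) (by norm_num))))
      (psiNeg_ne hq')) h1.symm
  obtain ⟨f, hf⟩ : ∃ f : ℂ → ℂ, f = fun q => ∑' n, a n * q ^ n := ⟨_, rfl⟩
  have hfs : ∀ q : ℂ, ‖q‖ < 1 → HasSum (fun n => a n * q ^ n) (f q) := fun q hq => by
    rw [hf]; exact (hsum q hq).hasSum
  have hwq : ∀ (q : ℂ) (i : ℕ), ‖q‖ < 1 → ‖w ^ i * q‖ < 1 := fun q i hq => by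
    rw [norm_mul, norm_pow, hwn, one_pow, one_mul]; exact hq
  have key : ∀ q : ℂ, ‖q‖ < 1 → HasSum
      (fun n => (a n * (1 + (-1) ^ n) * ∑ i ∈ Finset.range 5, (w ^ i) ^ (e + 3 + n)) * q ^ n)
      (∑ i ∈ Finset.range 5, (w ^ i) ^ (e + 3) * (f (w ^ i * q) + f (w ^ i * -q))) := by
    intro q hq
    have := hasSum_sum (s := Finset.range 5) fun i _ =>
      ((hfs _ (hwq q i hq)).add (hfs _ (hwq (-q) i (by simpa using hq)))).mul_left ((w ^ i) ^ (e + 3))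
    refine (funext fun n => ?_ : (fun n => (a n * (1 + (-1) ^ n) *
      ∑ i ∈ Finset.range 5, (w ^ i) ^ (e + 3 + n)) * q ^ n) = _) ▸ this
    rw [Finset.mul_sum, Finset.sum_mul]
    refine Finset.sum_congr rfl fun i _ => ?_
    rw [pow_add, mul_pow, mul_pow, neg_pow q n]
    ring
  refine ps_unique _ (fun q hq => (key q hq).summable) (fun q hq h0 => ?_) n
  rw [(key q hq).tsum_eq]
  obtain ⟨X, hX⟩ : ∃ X : ℂ → ℂ, ∀ q, X q = q * qpoch (q ^ 5) (q ^ 5) ^ 5 / qpoch q q := ⟨_, fun _ => rfl⟩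
  obtain ⟨Y, hY⟩ : ∃ Y : ℂ → ℂ, ∀ q, Y q = qpoch q q ^ 5 / qpoch (q ^ 5) (q ^ 5) := ⟨_, fun _ => rfl⟩
  obtain ⟨g0, g2, g3, hg⟩ := H_dissect h0 hq X Y hX hY w hw
  obtain ⟨k0, k2, k3, hk⟩ := H_dissect (neg_ne_zero.2 h0) (by simpa using hq) X Y hX hY w hw
  have hA : ∀ z : ℂ, z ≠ 0 → ‖z‖ < 1 →
      20 * (z ^ 3 * f z) = Y z - Y (z ^ 2) + 5 * X z - 15 * X (z ^ 2) := by
    intro z z0 hz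
    rw [← keyA z0 hz X Y hX hY, ← F_eq z0 hz X hX, hf]
    simp only
    rw [ha z hz]
  have hi : ∀ i : ℕ, 20 * q ^ 3 * ((w ^ i) ^ (e + 3) * (f (w ^ i * q) + f (w ^ i * -q))) =
      (g0 - k0) * (w ^ i) ^ e + (g2 - k2) * (w ^ i) ^ (e + 2) + (g3 - k3) * (w ^ i) ^ (e + 3) := by
    intro i
    have b1 := hA (w ^ i * q) (mul_ne_zero (pow_ne_zero i hw0) h0) (hwq q i hq)
    have b2 := hA (w ^ i * -q) (mul_ne_zero (pow_ne_zero i hw0) (neg_ne_zero.2 h0))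
      (hwq (-q) i (by simpa using hq))
    rw [show (w ^ i * -q) ^ 2 = (w ^ i * q) ^ 2 by ring] at b2
    have c1 := hg i
    have c2 := hk i
    rw [pow_add, pow_add (w ^ i) e 2]
    generalize w ^ i = x at *
    linear_combination x ^ e * (b1 - b2 + c1 - c2)
  have h20 : (20 : ℂ) * q ^ 3 ≠ 0 := mul_ne_zero (by norm_num) (pow_ne_zero 3 h0)
  refine (mul_eq_zero.1 ?_).resolve_left h20
  rw [Finset.mul_sum, Finset.sum_congr rfl fun i _ => hi i]
  rw [Finset.sum_add_distrib, Finset.sum_add_distrib, ← Finset.mul_sum, ← Finset.mul_sum,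
    ← Finset.mul_sum, he e (by simp), he (e + 2) (by simp), he (e + 3) (by simp)]
  ring

lemma sum_w (w : ℂ) (hw : w ^ 4 + w ^ 3 + w ^ 2 + w + 1 = 0) (k : ℕ) :
    ∑ i ∈ Finset.range 5, (w ^ i) ^ k = if k % 5 = 0 then 5 else 0 := by
  have h5 : w ^ 5 = 1 := by linear_combination (w - 1) * hw
  have e : ∀ i : ℕ, (w ^ i) ^ k = (w ^ i) ^ (k % 5) := by
    intro i
    have hx : (w ^ i) ^ 5 = 1 := by rw [← pow_mul, mul_comm, pow_mul, h5, one_pow]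
    conv_lhs => rw [← Nat.div_add_mod k 5, pow_add, pow_mul, hx, one_pow, one_mul]
  simp only [e]
  have hk : k % 5 < 5 := Nat.mod_lt _ (by norm_num)
  generalize k % 5 = r at *
  interval_cases r <;> simp [Finset.sum_range_succ, ← pow_mul] 
  · linear_combination hw
  · linear_combination hw + (w + w ^ 3) * h5
  · linear_combination hw + (w + w ^ 4 + w ^ 7 + w ^ 2) * h5
  · linear_combination hw + (w ^ 3 + w ^ 7 + w ^ 2 + w ^ 11 + w ^ 6 + w) * h5

lemma exists_w : ∃ w : ℂ, w ^ 4 + w ^ 3 + w ^ 2 + w + 1 = 0 := by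
  have h := Complex.isPrimitiveRoot_exp 5 (by norm_num)
  have := h.geom_sum_eq_zero (by norm_num)
  simp only [Finset.sum_range_succ, Finset.sum_range_zero] at this
  exact ⟨_, by linear_combination this⟩

theorem stmt_16 (b : ℕ → ℤ)
    (hb : ∀ q : ℂ, ‖q‖ < 1 →
      ∑' n : ℕ, (b n : ℂ) * q ^ n = psiNeg (q ^ 5) ^ 5 / psiNeg q) :
    ∀ n : ℕ, b (10 * n + 6) = 0 ∧ b (10 * n + 8) = 0 := by
  intro n
  obtain ⟨w, hw⟩ := exists_w
  have ha : ∀ q : ℂ, ‖q‖ < 1 → ∑' n : ℕ, ((b n : ℂ) * (-1) ^ n) * q ^ n =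
      psiNeg ((-q) ^ 5) ^ 5 / psiNeg (-q) := by
    intro q hq
    rw [← hb (-q) (by simpa using hq)]
    refine tsum_congr fun n => ?_
    rw [neg_pow q n]; ring
  constructor
  · have := main_vanish _ ha w hw 1 (by
      intro k hk
      rw [sum_w w hw, if_neg]
      simp at hk
      omega) (10 * n + 6)
    rw [sum_w w hw, if_pos (by omega), Even.neg_one_pow ⟨5 * n + 3, by ring⟩] at this
    norm_num at this
    exact this
  · have := main_vanish _ ha w hw 4 (by
      intro k hk
      rw [sum_w w hw, if_neg]
      simp at hk
      omega) (10 * n + 8)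
    rw [sum_w w hw, if_pos (by omega), Even.neg_one_pow ⟨5 * n + 4, by ring⟩] at this
    norm_num at this
    exact this
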